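/- arXiv:1808.10385 — 3 statements merged into one kernel-verified Lean document; each statement's English description precedes it below -/
import Mathlib

section
/- (Existence of non-periodic ground-state arrangements.) Assume the Jellium condition and, in addition, that σ̂(ξ) = 0 for every ξ ∈ Γ*_N \ Γ*_1 whose third coordinate ξ₃ lies in 2πℤ. Then for every r₃ ∈ ℝ and all maps a₁, a₂ : {0,…,N−1}² → ℝ, the arrangement q*(n) := (a₁(n₁,n₂), a₂(n₁,n₂), r₃) for n = (n₁,n₂,n₃) ∈ Γ_N satisfies ∑_{n∈Γ_N} σ(x−n−q*(n)) = eZ for all x ∈ ℝ³. -/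
noncomputable section

namespace SPN

open MeasureTheory Finset
open scoped Real

/-- Points of `ℝ³`. -/
abbrev V3 : Type := Fin 3 → ℝ

/-- Euclidean dot product on `ℝ³`. -/
def dotP (v w : V3) : ℝ := ∑ i, v i * w i

/-- Squared Euclidean norm on `ℝ³`. -/
def nsqV (v : V3) : ℝ := ∑ i, v i ^ 2

/-- The fundamental cube `[0,N)³` of the torus `T_N = ℝ³/(N·ℤ³)`. -/
def cubeN (N : ℕ) : Set V3 := {x | ∀ i, x i ∈ Set.Ico (0 : ℝ) (N : ℝ)}

/-- `N·ℤ³`-periodicity of a function on `ℝ³`. -/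
def IsPerN {α : Type*} (N : ℕ) (f : V3 → α) : Prop :=
  ∀ (x : V3) (k : Fin 3 → ℤ), f (x + fun i => (N : ℝ) * (k i : ℝ)) = f x

/-- Index set for `Γ_N = {0,…,N−1}³`. -/
abbrev GammaIdx (N : ℕ) : Type := Fin 3 → Fin N

/-- The lattice point of `Γ_N` associated to an index. -/
def embG {N : ℕ} (n : GammaIdx N) : V3 := fun i => ((n i : ℕ) : ℝ)

/-- Fourier coefficient `f̂(ξ) = ∫_{T_N} e^{iξ·x} f(x) dx`. -/
def fCoeff (N : ℕ) (f : V3 → ℂ) (ξ : V3) : ℂ :=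
  ∫ x in cubeN N, Complex.exp (Complex.I * ((dotP ξ x : ℝ) : ℂ)) * f x

/-- Fourier coefficient of a real-valued function. -/
def fCoeffR (N : ℕ) (f : V3 → ℝ) (ξ : V3) : ℂ :=
  fCoeff N (fun x => ((f x : ℝ) : ℂ)) ξ

/-- The point `(2π/N)·k` of the dual lattice `Γ*_N`. -/
def xiN (N : ℕ) (k : Fin 3 → ℤ) : V3 := fun i => (2 * π / (N : ℝ)) * (k i : ℝ)

/-- The Jellium condition: `σ̂(ξ) = 0` for all `ξ ∈ Γ*_1 \ {0}`. -/
def JelliumCond (N : ℕ) (σ : V3 → ℝ) : Prop :=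
  ∀ k : Fin 3 → ℤ, k ≠ 0 → fCoeffR N σ (fun i => 2 * π * (k i : ℝ)) = 0

/-- `(2π/N)·k ∈ Γ*_1`, i.e. every coordinate of `k` is divisible by `N`. -/
def inGamma1 (N : ℕ) (k : Fin 3 → ℤ) : Prop := ∀ i, (N : ℤ) ∣ k i

/-- `|∇φ(x)|²` for a complex-valued function. -/
def gradSq (φ : V3 → ℂ) (x : V3) : ℝ :=
  ∑ i, Complex.normSq (fderiv ℝ φ x (Pi.single i 1))

/-- Gradient of a real-valued function on `ℝ³`. -/
def gradV (f : V3 → ℝ) (x : V3) : V3 := fun i => fderiv ℝ f x (Pi.single i 1)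

/-- Total charge density `ρ(x) = ∑_n σ(x−n−q(n)) − e|ψ(x)|²`. -/
def rhoT (N : ℕ) (σ : V3 → ℝ) (e : ℝ) (ψ : V3 → ℂ) (q : GammaIdx N → V3) (x : V3) : ℝ :=
  (∑ n : GammaIdx N, σ (x - embG n - q n)) - e * Complex.normSq (ψ x)

/-- `∑_{ξ∈Γ*_N\{0}} |f̂(ξ)|²/|ξ|²`. -/
def dualSum (N : ℕ) (f : V3 → ℝ) : ℝ :=
  ∑' k : Fin 3 → ℤ, if k = 0 then 0 else
    Complex.normSq (fCoeffR N f (xiN N k)) / nsqV (xiN N k)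

/-- The energy functional `E(ψ,q,p)`. -/
def energyE (N : ℕ) (σ : V3 → ℝ) (e M : ℝ) (ψ : V3 → ℂ) (q p : GammaIdx N → V3) : ℝ :=
  (1 / 2) * (∫ x in cubeN N, gradSq ψ x)
    + (2 * (N : ℝ) ^ 3)⁻¹ * dualSum N (rhoT N σ e ψ q)
    + (2 * M)⁻¹ * ∑ n : GammaIdx N, nsqV (p n)

/-- The matrix `Σ(θ) = ∑_{m∈ℤ³} (ξξᵀ/|ξ|²)|σ̂(ξ)|²`, `ξ = θ + 2πm`. -/
def SigMat (N : ℕ) (σ : V3 → ℝ) (θ : V3) : Matrix (Fin 3) (Fin 3) ℝ :=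
  Matrix.of fun a b => ∑' m : Fin 3 → ℤ,
    ((θ a + 2 * π * (m a : ℝ)) * (θ b + 2 * π * (m b : ℝ))
        / nsqV (fun i => θ i + 2 * π * (m i : ℝ)))
      * Complex.normSq (fCoeffR N σ (fun i => θ i + 2 * π * (m i : ℝ)))

/-- The Wiener condition: `Σ(θ)` is positive definite for all `θ ∈ Γ*_N \ Γ*_1`. -/
def WienerCond (N : ℕ) (σ : V3 → ℝ) : Prop :=
  ∀ k : Fin 3 → ℤ, ¬ inGamma1 N k → (SigMat N σ (xiN N k)).PosDef

/-- First-order ionic density `σ⁽¹⁾(x) = −∑_n κ(n)·∇σ(x−n−r)`. -/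
def sigma1F (N : ℕ) (σ : V3 → ℝ) (r : V3) (κ : GammaIdx N → V3) (x : V3) : ℝ :=
  - ∑ n : GammaIdx N, dotP (κ n) (gradV σ (x - embG n - r))

/-- First-order charge density `ρ⁽¹⁾(x) = σ⁽¹⁾(x) − 2e√Z·Re(e^{−iα}φ(x))`. -/
def rho1F (N : ℕ) (σ : V3 → ℝ) (e Z α : ℝ) (r : V3) (κ : GammaIdx N → V3)
    (φ : V3 → ℂ) (x : V3) : ℝ :=
  sigma1F N σ r κ x - 2 * e * Real.sqrt Z * (Complex.exp (-Complex.I * (α : ℂ)) * φ x).re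

/-- The quadratic form `B(φ,κ,p)` (half of the energy Hessian). -/
def BformQ (N : ℕ) (σ : V3 → ℝ) (e Z M α : ℝ) (r : V3)
    (φ : V3 → ℂ) (κ p : GammaIdx N → V3) : ℝ :=
  (1 / 2) * (∫ x in cubeN N, gradSq φ x)
    + (2 * (N : ℝ) ^ 3)⁻¹ * dualSum N (rho1F N σ e Z α r κ φ)
    + (2 * M)⁻¹ * ∑ n : GammaIdx N, nsqV (p n)

/-- Second-order charge density `ρ⁽²⁾`. -/
def rho2F (N : ℕ) (σ : V3 → ℝ) (e : ℝ) (r : V3) (κ : GammaIdx N → V3)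
    (φ : V3 → ℂ) (x : V3) : ℝ :=
  (∑ n : GammaIdx N,
      (σ (x - embG n - r - κ n) - σ (x - embG n - r)
        + dotP (κ n) (gradV σ (x - embG n - r))))
    - e * Complex.normSq (φ x)

/-- The pairing `(f, Gg) = N⁻³ ∑_{ξ∈Γ*_N\{0}} Re(f̂(ξ)·conj(ĝ(ξ)))/|ξ|²`. -/
def GPair (N : ℕ) (f g : V3 → ℝ) : ℝ :=
  ((N : ℝ) ^ 3)⁻¹ * ∑' k : Fin 3 → ℤ, if k = 0 then 0 else
    (fCoeffR N f (xiN N k) * (starRingEnd ℂ) (fCoeffR N g (xiN N k))).re / nsqV (xiN N k)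

/-- The distance to the solitary manifold of ground states. -/
def distS (N : ℕ) (Z : ℝ) (ψ : V3 → ℂ) (q p : GammaIdx N → V3) : ℝ :=
  ⨅ (α : ℝ) (r : V3),
    (Real.sqrt (∫ x in cubeN N,
        (Complex.normSq (ψ x - Complex.exp (Complex.I * (α : ℂ)) * ((Real.sqrt Z : ℝ) : ℂ))
          + gradSq ψ x))
      + Real.sqrt (∑ n : GammaIdx N, ⨅ k : Fin 3 → ℤ,
          nsqV (fun i => q n i - r i - (N : ℝ) * (k i : ℝ)))
      + Real.sqrt (∑ n : GammaIdx N, nsqV (p n)))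

/-- The discrete Fourier transform `κ̂(θ) ∈ ℂ³` of `κ : Γ_N → ℝ³`. -/
def hatK (N : ℕ) (κ : GammaIdx N → V3) (θ : V3) (a : Fin 3) : ℂ :=
  ∑ n : GammaIdx N, Complex.exp (Complex.I * ((dotP θ (embG n) : ℝ) : ℂ)) * ((κ n a : ℝ) : ℂ)

/-- Laplacian of a complex-valued function on `ℝ³`. -/
def lapC (f : V3 → ℂ) (x : V3) : ℂ :=
  ∑ i, fderiv ℝ (fun y => fderiv ℝ f y (Pi.single i 1)) x (Pi.single i 1)

/-- Laplacian of a real-valued function on `ℝ³`. -/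
def lapR (f : V3 → ℝ) (x : V3) : ℝ :=
  ∑ i, fderiv ℝ (fun y => fderiv ℝ f y (Pi.single i 1)) x (Pi.single i 1)

/-- A classical solution of the Schrödinger–Poisson–Newton system on `ℝ`. -/
structure IsSPN (N : ℕ) (σ : V3 → ℝ) (e M : ℝ)
    (ψ : V3 → ℝ → ℂ) (Φ : V3 → ℝ → ℝ) (q : ℝ → GammaIdx N → V3) : Prop where
  per_psi : ∀ t : ℝ, IsPerN N (fun x => ψ x t)
  per_Phi : ∀ t : ℝ, IsPerN N (fun x => Φ x t)
  regx_psi : ∀ t : ℝ, ContDiff ℝ 2 (fun x => ψ x t)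
  regt_psi : ∀ x : V3, ContDiff ℝ 1 (fun t => ψ x t)
  regx_Phi : ∀ t : ℝ, ContDiff ℝ 2 (fun x => Φ x t)
  regt_Phi : ∀ x : V3, ContDiff ℝ 1 (fun t => Φ x t)
  reg_q : ContDiff ℝ 2 q
  schrodinger : ∀ (x : V3) (t : ℝ),
    Complex.I * deriv (fun s => ψ x s) t =
      -(1 / 2 : ℂ) * lapC (fun y => ψ y t) x - ((e : ℝ) : ℂ) * ((Φ x t : ℝ) : ℂ) * ψ x t
  poisson : ∀ (x : V3) (t : ℝ),
    - lapR (fun y => Φ y t) x =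
      (∑ n : GammaIdx N, σ (x - embG n - q t n)) - e * Complex.normSq (ψ x t)
  newton : ∀ (n : GammaIdx N) (t : ℝ) (i : Fin 3),
    M * deriv (fun s => deriv (fun u => q u n i) s) t =
      - ∫ x in cubeN N, fderiv ℝ (fun y => Φ y t) x (Pi.single i 1) * σ (x - embG n - q t n)

theorem mF_add (n : Fin 3 → ℤ) (x y : UnitAddTorus (Fin 3)) :
    UnitAddTorus.mFourier n (x + y) = UnitAddTorus.mFourier n x * UnitAddTorus.mFourier n y := by
  simp only [UnitAddTorus.mFourier, ContinuousMap.coe_mk, ← Finset.prod_mul_distrib]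
  refine Finset.prod_congr rfl fun i _ => ?_
  simp [fourier_apply, AddCircle.toCircle_add]

theorem coeff_eq_pi (f : UnitAddTorus (Fin 3) → ℂ) (n : Fin 3 → ℤ) :
    UnitAddTorus.mFourierCoeff f n = ∫ t, UnitAddTorus.mFourier (-n) t * f t
      ∂(Measure.pi fun _ : Fin 3 => (AddCircle.haarAddCircle : Measure UnitAddCircle)) := rfl

theorem coeff_shift (f : UnitAddTorus (Fin 3) → ℂ) (n : Fin 3 → ℤ) (v : UnitAddTorus (Fin 3)) :
    UnitAddTorus.mFourierCoeff (fun y => f (y - v)) n =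
      UnitAddTorus.mFourier (-n) v * UnitAddTorus.mFourierCoeff f n := by
  rw [coeff_eq_pi, coeff_eq_pi, ← integral_const_mul]
  rw [← integral_sub_right_eq_self
    (fun t => UnitAddTorus.mFourier (-n) v * (UnitAddTorus.mFourier (-n) t * f t)) v]
  refine integral_congr_ae (Filter.Eventually.of_forall fun t => ?_)
  have h := mF_add (-n) v (t - v)
  rw [add_sub_cancel] at h
  simp only [h, mul_assoc]

theorem exists_lift (N : ℕ) (σ : V3 → ℝ) (hper : IsPerN N σ) (hc : Continuous σ) :
    ∃ G : C(UnitAddTorus (Fin 3), ℂ), ∀ t : V3,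
      G (fun i => (t i : UnitAddCircle)) = ((σ ((N : ℝ) • t) : ℝ) : ℂ) := by
  have hq : IsOpenQuotientMap
      (Pi.map (fun (_ : Fin 3) (x : ℝ) => (x : UnitAddCircle))) :=
    IsOpenQuotientMap.piMap fun _ => QuotientAddGroup.isOpenQuotientMap_mk
  let s := Function.surjInv hq.surjective
  have hs : ∀ y, Pi.map (fun (_ : Fin 3) (x : ℝ) => (x : UnitAddCircle)) (s y) = y :=
    Function.surjInv_eq hq.surjective
  let g : UnitAddTorus (Fin 3) → ℂ := fun y => ((σ ((N : ℝ) • s y) : ℝ) : ℂ)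
  have hg : ∀ t : V3, g (fun i => (t i : UnitAddCircle)) = ((σ ((N : ℝ) • t) : ℝ) : ℂ) := by
    intro t
    have h1 := hs (fun i => (t i : UnitAddCircle))
    have h2 : ∀ i, ∃ m : ℤ, s (fun i => (t i : UnitAddCircle)) i = t i + m := by
      intro i
      have h3 := congrFun h1 i
      simp only [Pi.map_apply] at h3
      obtain ⟨m, hm⟩ := AddSubgroup.mem_zmultiples_iff.1 (QuotientAddGroup.eq_iff_sub_mem.1 h3)
      refine ⟨m, ?_⟩
      simp at hm
      linarith
    choose m hm using h2
    have : (N : ℝ) • s (fun i => (t i : UnitAddCircle))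
        = (N : ℝ) • t + fun i => (N : ℝ) * (m i : ℝ) := by
      ext i
      simp [hm i, mul_add]
    simp only [g]
    rw [this, hper]
  have hgc : Continuous g := by
    rw [← hq.continuous_comp_iff]
    have : g ∘ Pi.map (fun (_ : Fin 3) (x : ℝ) => (x : UnitAddCircle))
        = fun t : V3 => ((σ ((N : ℝ) • t) : ℝ) : ℂ) := by
      ext t; exact hg t
    rw [this]
    fun_prop
  exact ⟨⟨g, hgc⟩, hg⟩

open scoped Pointwise in
theorem smul_cube (N : ℕ) (hN : 0 < N) :
    (N : ℝ) • ({x : V3 | ∀ i, x i ∈ Set.Ico (0 : ℝ) 1}) = cubeN N := by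
  have hN' : (0 : ℝ) < N := by exact_mod_cast hN
  ext x
  rw [Set.mem_smul_set_iff_inv_smul_mem₀ hN'.ne']
  simp only [cubeN, Set.mem_setOf_eq, Pi.smul_apply, smul_eq_mul, Set.mem_Ico]
  refine forall_congr' fun i => ?_
  rw [inv_mul_eq_div, div_lt_one hN', le_div_iff₀ hN', zero_mul]

theorem coeff_lift (N : ℕ) (hN : 0 < N) (σ : V3 → ℝ) (G : C(UnitAddTorus (Fin 3), ℂ))
    (hG : ∀ t : V3, G (fun i => (t i : UnitAddCircle)) = ((σ ((N : ℝ) • t) : ℝ) : ℂ))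
    (k : Fin 3 → ℤ) :
    UnitAddTorus.mFourierCoeff G k = ((N : ℂ) ^ 3)⁻¹ * fCoeffR N σ (xiN N (-k)) := by
  have hN' : (0 : ℝ) < N := by exact_mod_cast hN
  have hNC : (N : ℂ) ≠ 0 := by exact_mod_cast hN.ne'
  rw [UnitAddTorus.mFourierCoeff_eq_integral _ _ 0]
  have hset : ({x : V3 | ∀ i, x i ∈ Set.Ioc ((0 : V3) i) ((0 : V3) i + 1)} : Set V3)
      =ᵐ[volume] {x : V3 | ∀ i, x i ∈ Set.Ico (0 : ℝ) 1} := by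
    have h1 := Measure.univ_pi_Ioc_ae_eq_Icc (μ := fun _ : Fin 3 => (volume : Measure ℝ))
      (f := 0) (g := 1)
    have h2 := Measure.univ_pi_Ico_ae_eq_Icc (μ := fun _ : Fin 3 => (volume : Measure ℝ))
      (f := 0) (g := 1)
    have h3 := h1.trans h2.symm
    have e1 : ({x : V3 | ∀ i, x i ∈ Set.Ioc ((0 : V3) i) ((0 : V3) i + 1)} : Set V3)
        = Set.univ.pi fun i => Set.Ioc ((0 : V3) i) ((1 : V3) i) := by
      ext x; simp [Set.mem_pi]
    have e2 : ({x : V3 | ∀ i, x i ∈ Set.Ico (0 : ℝ) 1} : Set V3)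
        = Set.univ.pi fun i => Set.Ico ((0 : V3) i) ((1 : V3) i) := by
      ext x; simp [Set.mem_pi]
    rw [e1, e2]
    exact h3
  rw [setIntegral_congr_set hset]
  have h := Measure.setIntegral_comp_smul_of_pos (volume : Measure V3)
    (fun x : V3 => Complex.exp (Complex.I * ((dotP (xiN N (-k)) x : ℝ) : ℂ)) * ((σ x : ℝ) : ℂ))
    {x : V3 | ∀ i, x i ∈ Set.Ico (0 : ℝ) 1} hN'
  rw [smul_cube N hN] at h
  simp only [fCoeffR, fCoeff]
  have hf : Module.finrank ℝ V3 = 3 := by simp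
  rw [hf] at h
  have h' : ((N : ℂ) ^ 3)⁻¹ = (((((N : ℝ) ^ 3)⁻¹ : ℝ)) : ℂ) := by push_cast; rfl
  rw [h', ← Complex.real_smul, ← h]
  refine integral_congr_ae (Filter.Eventually.of_forall fun t => ?_)
  simp only [hG, smul_eq_mul]
  congr 1
  simp only [UnitAddTorus.mFourier, ContinuousMap.coe_mk, fourier_coe_apply]
  rw [← Complex.exp_sum]
  congr 1
  simp only [dotP, xiN, Complex.ofReal_sum, Finset.mul_sum]
  refine Finset.sum_congr rfl fun i _ => ?_
  simp
  field_simp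

theorem geom_zero (N : ℕ) (hN : 0 < N) (j : ℤ) (hj : ¬ (N : ℤ) ∣ j) :
    ∑ m : Fin N, Complex.exp (2 * π * Complex.I * j * ((m : ℕ) / N : ℂ)) = 0 := by
  have hNC : (N : ℂ) ≠ 0 := by exact_mod_cast hN.ne'
  set w := Complex.exp (2 * π * Complex.I * j / N) with hw
  have h1 : ∀ m : ℕ, Complex.exp (2 * π * Complex.I * j * ((m : ℕ) / N : ℂ)) = w ^ m := by
    intro m
    rw [hw, ← Complex.exp_nat_mul]
    congr 1
    ring
  simp only [h1]
  rw [Fin.sum_univ_eq_sum_range (fun m => w ^ m) N]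
  have hw1 : w ≠ 1 := by
    intro h
    rw [hw, Complex.exp_eq_one_iff] at h
    obtain ⟨n, hn⟩ := h
    apply hj
    refine ⟨n, ?_⟩
    have h2 := Complex.two_pi_I_ne_zero
    have : (j : ℂ) = N * n := by
      field_simp at hn
      linear_combination hn
    exact_mod_cast this
  rw [geom_sum_eq hw1]
  have : w ^ N = 1 := by
    rw [hw, ← Complex.exp_nat_mul, Complex.exp_eq_one_iff]
    exact ⟨j, by field_simp⟩
  rw [this]; simp

theorem layer_const (N : ℕ) (hN : 0 < N) (σ : V3 → ℝ) (e Z : ℝ)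
    (hper : IsPerN N σ) (hreg : ContDiff ℝ 2 σ)
    (hint : (∫ x in cubeN N, σ x) = e * Z)
    (hJ : JelliumCond N σ)
    (hspec : ∀ k : Fin 3 → ℤ, ¬ inGamma1 N k → (N : ℤ) ∣ k 2 → fCoeffR N σ (xiN N k) = 0)
    (x : V3) :
    ∑ m : Fin N, σ (x - ![0, 0, ((m : ℕ) : ℝ)]) = ((N : ℝ) ^ 2)⁻¹ * (e * Z) := by
  have hN' : (N : ℝ) ≠ 0 := by exact_mod_cast hN.ne'
  have hNC : (N : ℂ) ≠ 0 := by exact_mod_cast hN.ne'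
  obtain ⟨G, hG⟩ := exists_lift N σ hper hreg.continuous
  let v : Fin N → V3 := fun m => ![0, 0, ((m : ℕ) : ℝ) / N]
  let vt : Fin N → UnitAddTorus (Fin 3) := fun m i => (v m i : UnitAddCircle)
  let H : C(UnitAddTorus (Fin 3), ℂ) := ⟨fun y => ∑ m, G (y - vt m), by fun_prop⟩
  have hH : ∀ k, UnitAddTorus.mFourierCoeff H k =
      (∑ m, UnitAddTorus.mFourier (-k) (vt m)) * UnitAddTorus.mFourierCoeff G k := by
    intro k
    rw [Finset.sum_mul]
    simp only [← coeff_shift]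
    simp only [coeff_eq_pi]
    rw [← integral_finsetSum]
    · simp [H, Finset.mul_sum]
    · intro m _
      apply Continuous.integrable_of_hasCompactSupport
      · fun_prop
      · exact HasCompactSupport.of_compactSpace _
  have hv : ∀ k m, UnitAddTorus.mFourier (-k) (vt m) =
      Complex.exp (2 * π * Complex.I * ((-k 2 : ℤ) : ℂ) * ((m : ℕ) / N : ℂ)) := by
    intro k m
    simp only [UnitAddTorus.mFourier, ContinuousMap.coe_mk, vt, fourier_coe_apply,
      Fin.prod_univ_three, v]
    simp
  have hH0 : ∀ k, k ≠ 0 → UnitAddTorus.mFourierCoeff H k = 0 := by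
    intro k hk
    rw [hH]
    by_cases h2 : (N : ℤ) ∣ k 2
    · rw [coeff_lift N hN σ G hG]
      by_cases h3 : inGamma1 N k
      · choose l hl using h3
        have : xiN N (-k) = fun i => 2 * π * (((-l) i : ℤ) : ℝ) := by
          ext i
          simp [xiN, hl i]
          field_simp
        rw [this, hJ]
        · simp
        · intro h
          apply hk
          ext i
          have := congrFun h i
          simp at this
          simp [hl i, this]
      · rw [hspec (-k)]
        · simp
        · intro h
          apply h3
          intro i
          simpa using h i
        · simpa using h2
    · simp only [hv]
      rw [geom_zero N hN _ (by simpa using h2), zero_mul]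
  have hH00 : UnitAddTorus.mFourierCoeff H 0 = (((N : ℝ) ^ 2)⁻¹ * (e * Z) : ℝ) := by
    rw [hH, coeff_lift N hN σ G hG]
    simp only [hv]
    have : fCoeffR N σ (xiN N (-0)) = ((e * Z : ℝ) : ℂ) := by
      rw [← hint, ← integral_complex_ofReal]
      simp [fCoeffR, fCoeff, xiN, dotP]
    rw [this]
    simp
    field_simp
  have hsum : Summable (UnitAddTorus.mFourierCoeff H) :=
    summable_of_ne_finset_zero (s := {0}) (fun k hk => hH0 k (by simpa using hk))
  let t : V3 := (N : ℝ)⁻¹ • x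
  have h1 := UnitAddTorus.hasSum_mFourier_series_apply_of_summable hsum
    (fun i => (t i : UnitAddCircle))
  have h2 := h1.unique (hasSum_single 0 (fun k hk => by rw [hH0 k hk, zero_smul]))
  rw [hH00, UnitAddTorus.mFourier_zero] at h2
  have h3 : H (fun i => (t i : UnitAddCircle)) =
      ((∑ m : Fin N, σ (x - ![0, 0, ((m : ℕ) : ℝ)]) : ℝ) : ℂ) := by
    simp only [H, ContinuousMap.coe_mk, Complex.ofReal_sum]
    refine Finset.sum_congr rfl fun m _ => ?_
    have h4 := hG (t - v m)
    have h5 : (N : ℝ) • (t - v m) = x - ![0, 0, ((m : ℕ) : ℝ)] := by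
      ext i
      fin_cases i <;> simp [t, v, Matrix.vecHead, Matrix.vecTail] <;> field_simp
    rw [h5] at h4
    rw [← h4]
    rfl
  rw [h3] at h2
  simp only [ContinuousMap.one_apply, smul_eq_mul, mul_one] at h2
  exact_mod_cast h2

/-- existence of non-periodic ground-state arrangements. -/
theorem stmt3 (N : ℕ) (hN : 0 < N) (σ : V3 → ℝ) (e Z : ℝ) (he : 0 < e) (hZ : 0 < Z)
    (hper : IsPerN N σ) (hreg : ContDiff ℝ 2 σ)
    (hint : (∫ x in cubeN N, σ x) = e * Z)
    (hJ : JelliumCond N σ)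
    (hspec : ∀ k : Fin 3 → ℤ, ¬ inGamma1 N k → (N : ℤ) ∣ k 2 → fCoeffR N σ (xiN N k) = 0) :
    ∀ (r3 : ℝ) (a1 a2 : Fin N → Fin N → ℝ) (x : V3),
      (∑ n : GammaIdx N, σ (x - embG n - ![a1 (n 0) (n 1), a2 (n 0) (n 1), r3])) = e * Z := by
  intro r3 a1 a2 x
  have hN' : (N : ℝ) ≠ 0 := by exact_mod_cast hN.ne'
  have hL := layer_const N hN σ e Z hper hreg hint hJ hspec
  rw [← (Fin.snocEquiv (fun _ : Fin 3 => Fin N)).sum_comp, Fintype.sum_prod_type_right]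
  have : ∀ p : Fin 2 → Fin N, ∑ m : Fin N,
      (fun n : GammaIdx N => σ (x - embG n - ![a1 (n 0) (n 1), a2 (n 0) (n 1), r3]))
        ((Fin.snocEquiv (fun _ : Fin 3 => Fin N)) (m, p)) = ((N : ℝ) ^ 2)⁻¹ * (e * Z) := by
    intro p
    rw [← hL (x - ![((p 0 : ℕ) : ℝ) + a1 (p 0) (p 1), ((p 1 : ℕ) : ℝ) + a2 (p 0) (p 1), r3])]
    refine Finset.sum_congr rfl fun m _ => ?_
    have e0 : (Fin.snocEquiv (fun _ : Fin 3 => Fin N)) (m, p) 0 = p 0 := rfl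
    have e1 : (Fin.snocEquiv (fun _ : Fin 3 => Fin N)) (m, p) 1 = p 1 := rfl
    have e2 : (Fin.snocEquiv (fun _ : Fin 3 => Fin N)) (m, p) 2 = m := rfl
    simp only [e0, e1]
    congr 1
    ext i
    fin_cases i
    · simp [embG, e0, Matrix.vecHead, Matrix.vecTail]; ring
    · simp [embG, e1, Matrix.vecHead, Matrix.vecTail]; ring
    · simp [embG, e2, Matrix.vecHead, Matrix.vecTail]; ring
  refine (Finset.sum_congr rfl fun p _ => this p).trans ?_
  simp
  field_simp

end SPN
end
end

section
/- (Description of ground states.) Assume the Jellium condition. Then: (i) E(ψ,q,p) ≥ 0 for all ψ, q, p; (ii) if moreover ∫_{T_N}|ψ(x)|² dx = Z·N³, then E(ψ,q,p) = 0 if and only if there exists α ∈ ℝ such that ψ(x) = e^{iα}√Z for all x, p(n) = 0 for all n ∈ Γ_N, and ∑_{n∈Γ_N} σ(x−n−q(n)) = eZ for all x ∈ ℝ³. -/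
noncomputable section

namespace SPN

open MeasureTheory Finset
open scoped Real

lemma torus_lift (N : ℕ) (hN : 0 < N) {F : Type*} [TopologicalSpace F] (f : V3 → F)
    (hf : Continuous f) (hp : IsPerN N f) :
    ∃ g : C(UnitAddTorus (Fin 3), F), ∀ t : V3,
      g (fun i => ((t i : ℝ) : UnitAddCircle)) = f ((N : ℝ) • t) := by
  have hq : IsOpenQuotientMap (Pi.map (fun (_ : Fin 3) (t : ℝ) => (t : UnitAddCircle))) :=
    IsOpenQuotientMap.piMap (fun _ => QuotientAddGroup.isOpenQuotientMap_mk)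
  let F0 : C(V3, F) := ⟨fun t => f ((N : ℝ) • t), by fun_prop⟩
  let P : C(V3, UnitAddTorus (Fin 3)) := ⟨_, hq.continuous⟩
  have hP : Topology.IsQuotientMap P := hq.isQuotientMap
  have hfac : Function.FactorsThrough F0 P := by
    intro a b hab
    have h1 : ∀ i, ∃ k : ℤ, b i = a i + k := by
      intro i
      have h2 : ((a i : ℝ) : UnitAddCircle) = ((b i : ℝ) : UnitAddCircle) := congrFun hab i
      rw [eq_comm, ← sub_eq_zero, ← AddCircle.coe_sub, AddCircle.coe_eq_zero_iff] at h2
      obtain ⟨k, hk⟩ := h2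
      refine ⟨k, ?_⟩
      simp at hk
      linarith
    choose k hk using h1
    have : (N : ℝ) • b = (N : ℝ) • a + fun i => (N : ℝ) * (k i : ℝ) := by
      ext i
      simp [hk i]; ring
    change f _ = f _
    rw [this, hp]
  refine ⟨hP.lift F0 hfac, fun t => ?_⟩
  have := hP.lift_comp F0 hfac
  exact DFunLike.congr_fun this t

local instance instMSC : MeasureSpace UnitAddCircle := ⟨AddCircle.haarAddCircle⟩

local instance instHaarC : Measure.IsAddHaarMeasure (volume : Measure UnitAddCircle) :=
  inferInstanceAs (Measure.IsAddHaarMeasure AddCircle.haarAddCircle)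

local instance instProbC : IsProbabilityMeasure (volume : Measure UnitAddCircle) :=
  inferInstanceAs (IsProbabilityMeasure AddCircle.haarAddCircle)

open scoped Pointwise in
lemma torus_int (N : ℕ) (hN : 0 < N) {F : Type*} [NormedAddCommGroup F] [NormedSpace ℝ F]
    (h : V3 → F) (g : UnitAddTorus (Fin 3) → F)
    (hg : ∀ t : V3, g (fun i => ((t i : ℝ) : UnitAddCircle)) = h ((N : ℝ) • t)) :
    ∫ x in cubeN N, h x = ((N : ℝ) ^ 3) • ∫ y : UnitAddTorus (Fin 3), g y := by
  have hN' : (0 : ℝ) < N := by exact_mod_cast hN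
  rw [UnitAddTorus.integral_preimage g (fun _ => 0)]
  simp_rw [hg]
  have e1 : ({x : V3 | ∀ i, x i ∈ Set.Ioc (0 : ℝ) (0 + 1)} : Set V3) =ᵐ[volume] cubeN 1 := by
    have a1 := Measure.univ_pi_Ioc_ae_eq_Icc (μ := fun _ : Fin 3 => (volume : Measure ℝ))
      (f := fun _ => 0) (g := fun _ => 1)
    have a2 := Measure.univ_pi_Ico_ae_eq_Icc (μ := fun _ : Fin 3 => (volume : Measure ℝ))
      (f := fun _ => 0) (g := fun _ => 1)
    have a3 := a1.trans a2.symm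
    have b1 : ({x : V3 | ∀ i, x i ∈ Set.Ioc (0 : ℝ) (0 + 1)} : Set V3)
      = Set.univ.pi fun _ => Set.Ioc 0 1 := by ext; simp
    have b2 : cubeN 1 = Set.univ.pi fun _ => Set.Ico 0 1 := by ext; simp [cubeN]
    rw [b1, b2]
    exact a3
  rw [setIntegral_congr_set e1, Measure.setIntegral_comp_smul_of_pos volume h _ hN']
  have e2 : (N : ℝ) • cubeN 1 = cubeN N := by
    ext x
    rw [Set.mem_smul_set_iff_inv_smul_mem₀ hN'.ne']
    simp only [cubeN, Set.mem_setOf_eq, Set.mem_Ico, Pi.smul_apply, smul_eq_mul]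
    refine forall_congr' fun i => ?_
    rw [inv_mul_eq_div, le_div_iff₀ hN', div_lt_iff₀ hN']
    simp
  rw [e2, smul_smul]
  simp [hN'.ne']

lemma int_translate (N : ℕ) (hN : 0 < N) (f : V3 → ℝ)
    (hf : Continuous f) (hp : IsPerN N f) (a : V3) :
    ∫ x in cubeN N, f (x - a) = ∫ x in cubeN N, f x := by
  have hN' : (0 : ℝ) < N := by exact_mod_cast hN
  obtain ⟨g, hg⟩ := torus_lift N hN f hf hp
  rw [torus_int N hN f g hg]
  rw [torus_int N hN (fun x => f (x - a))
    (fun y => g (y - (fun i => ((a i / N : ℝ) : UnitAddCircle)))) ?_]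
  · rw [integral_sub_right_eq_self]
  · intro t
    have := hg (t - (N : ℝ)⁻¹ • a)
    rw [smul_sub, smul_smul, mul_inv_cancel₀ hN'.ne', one_smul] at this
    rw [← this]
    congr 1
    ext i
    simp [div_eq_inv_mul]

lemma nonneg_int_zero (N : ℕ) (hN : 0 < N) (f : V3 → ℝ)
    (hf : Continuous f) (hp : IsPerN N f) (h0 : ∀ x, 0 ≤ f x) (hi : ∫ x in cubeN N, f x = 0) :
    ∀ x, f x = 0 := by
  have hN' : (0 : ℝ) < N := by exact_mod_cast hN
  obtain ⟨g, hg⟩ := torus_lift N hN f hf hp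
  have hx : ∀ x : V3, f x = g (fun i => ((x i / N : ℝ) : UnitAddCircle)) := by
    intro x
    have := hg ((N : ℝ)⁻¹ • x)
    rw [smul_smul, mul_inv_cancel₀ hN'.ne', one_smul] at this
    rw [← this]
    congr 1
    ext i
    simp [div_eq_inv_mul]
  rw [torus_int N hN f g hg] at hi
  have hi' : ∫ y, g y = 0 := by simpa [hN'.ne'] using hi
  have g0 : ∀ y, 0 ≤ g y := by
    intro y
    obtain ⟨t, rfl⟩ : ∃ t : V3, (fun i => ((t i : ℝ) : UnitAddCircle)) = y := by
      have : ∀ i, ∃ s : ℝ, (s : UnitAddCircle) = y i := fun i => QuotientAddGroup.mk_surjective _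
      choose t ht using this
      exact ⟨t, funext ht⟩
    rw [hg]; exact h0 _
  have hint : Integrable g (volume : Measure (UnitAddTorus (Fin 3))) :=
    g.continuous.integrable_of_hasCompactSupport (HasCompactSupport.of_compactSpace _)
  rw [integral_eq_zero_iff_of_nonneg g0 hint] at hi'
  have := Continuous.ae_eq_iff_eq volume g.continuous continuous_const |>.1 hi'
  intro x
  rw [hx, this]
  rfl

lemma fCoeff_eq (N : ℕ) (hN : 0 < N) (f : V3 → ℂ) (g : UnitAddTorus (Fin 3) → ℂ)
    (hg : ∀ t : V3, g (fun i => ((t i : ℝ) : UnitAddCircle)) = f ((N : ℝ) • t))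
    (k : Fin 3 → ℤ) :
    fCoeff N f (xiN N k) = ((N : ℝ) ^ 3) • UnitAddTorus.mFourierCoeff g (-k) := by
  have hN' : (N : ℂ) ≠ 0 := by exact_mod_cast hN.ne'
  unfold fCoeff UnitAddTorus.mFourierCoeff
  apply torus_int N hN
  intro t
  rw [hg, smul_eq_mul, neg_neg]
  congr 1
  simp only [UnitAddTorus.mFourier, ContinuousMap.coe_mk, fourier_coe_apply]
  rw [← Complex.exp_sum]
  congr 1
  simp only [dotP, xiN, Fin.sum_univ_three, Pi.smul_apply, smul_eq_mul]
  push_cast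
  field_simp

lemma summ_zero (N : ℕ) (hN : 0 < N) (f : V3 → ℝ)
    (hf : Continuous f) (hp : IsPerN N f) (hi : ∫ x in cubeN N, f x = 0)
    (hd : dualSum N f = 0) : ∀ x, f x = 0 := by
  have hN' : (0 : ℝ) < N := by exact_mod_cast hN
  obtain ⟨g, hg⟩ := torus_lift N hN (fun x => (f x : ℂ)) (by fun_prop)
    (fun x k => congrArg (fun r : ℝ => (r : ℂ)) (hp x k))
  have hc := fCoeff_eq N hN (fun x => (f x : ℂ)) g hg
  have hs0 := (UnitAddTorus.hasSum_sq_mFourierCoeff (ContinuousMap.toLp 2 volume ℂ g)).summable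
  simp only [UnitAddTorus.mFourierCoeff_toLp] at hs0
  have hs1 : Summable fun k : Fin 3 → ℤ => ‖UnitAddTorus.mFourierCoeff g (-k)‖ ^ 2 :=
    hs0.comp_injective neg_injective
  have hs2 : Summable fun k : Fin 3 → ℤ => Complex.normSq (fCoeffR N f (xiN N k)) := by
    refine (hs1.mul_left (((N : ℝ) ^ 3) ^ 2)).congr fun k => ?_
    unfold fCoeffR
    rw [hc, Complex.normSq_eq_norm_sq, norm_smul, mul_pow]
    simp
  have hlow : ∀ k : Fin 3 → ℤ, k ≠ 0 → (2 * π / N) ^ 2 ≤ nsqV (xiN N k) := by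
    intro k hk
    obtain ⟨i, hi⟩ := Function.ne_iff.1 hk
    have h1 : (xiN N k i) ^ 2 ≤ nsqV (xiN N k) :=
      Finset.single_le_sum (f := fun i => (xiN N k i) ^ 2) (fun _ _ => sq_nonneg _)
        (Finset.mem_univ i)
    refine le_trans ?_ h1
    simp only [xiN, mul_pow]
    have : (1 : ℝ) ≤ (k i : ℝ) ^ 2 := by
      have : (1 : ℤ) ≤ (k i) ^ 2 := by
        have : 0 < (k i) ^ 2 := by
          have : k i ≠ 0 := hi
          positivity
        omega
      exact_mod_cast this
    exact le_mul_of_one_le_right (by positivity) this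
  have hpos : (0 : ℝ) < (2 * π / N) ^ 2 := by positivity
  have hnn : ∀ k : Fin 3 → ℤ, 0 ≤ if k = 0 then 0 else
    Complex.normSq (fCoeffR N f (xiN N k)) / nsqV (xiN N k) := by
    intro k
    split_ifs with h
    · exact le_rfl
    · exact div_nonneg (Complex.normSq_nonneg _) (hpos.le.trans (hlow k h))
  have hs3 : Summable fun k : Fin 3 → ℤ => if k = 0 then 0 else
    Complex.normSq (fCoeffR N f (xiN N k)) / nsqV (xiN N k) := by
    refine Summable.of_nonneg_of_le hnn (fun k => ?_) (hs2.mul_right ((2 * π / N) ^ 2)⁻¹)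
    split_ifs with h
    · exact mul_nonneg (Complex.normSq_nonneg _) (inv_nonneg.2 hpos.le)
    · rw [div_eq_mul_inv]
      exact mul_le_mul_of_nonneg_left (inv_anti₀ hpos (hlow k h)) (Complex.normSq_nonneg _)
  have hz : ∀ k : Fin 3 → ℤ, fCoeffR N f (xiN N k) = 0 := by
    intro k
    by_cases hk : k = 0
    · subst hk
      have : fCoeffR N f (xiN N 0) = ((∫ x in cubeN N, f x : ℝ) : ℂ) := by
        unfold fCoeffR fCoeff
        rw [← integral_complex_ofReal]
        simp [dotP, xiN]
      rw [this, hi]; simp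
    · have h1 := (hasSum_zero_iff_of_nonneg hnn).1 (by
        have := hs3.hasSum
        rwa [show (∑' k : Fin 3 → ℤ, if k = 0 then 0 else
          Complex.normSq (fCoeffR N f (xiN N k)) / nsqV (xiN N k)) = 0 from hd] at this)
      have h2 := congrFun h1 k
      simp only [hk, if_false, Pi.zero_apply, div_eq_zero_iff] at h2
      rcases h2 with h2 | h2
      · exact Complex.normSq_eq_zero.1 h2
      · have := hlow k hk
        linarith
  have hm : UnitAddTorus.mFourierCoeff g = 0 := by
    ext k
    have h1 := hc (-k)
    rw [neg_neg] at h1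
    have h2 := hz (-k)
    unfold fCoeffR at h2
    rw [h1] at h2
    simpa [hN.ne'] using h2
  have hsum := UnitAddTorus.hasSum_mFourier_series_of_summable (f := g)
    (by rw [hm]; exact summable_zero)
  rw [hm] at hsum
  have hg0 : g = 0 := by
    refine hsum.unique ?_
    have hz0 : HasSum (fun _ : Fin 3 → ℤ => (0 : C(UnitAddTorus (Fin 3), ℂ))) 0 := hasSum_zero
    refine hz0.congr_fun fun k => ?_
    ext y
    simp
  intro x
  have := hg ((N : ℝ)⁻¹ • x)
  rw [smul_smul, mul_inv_cancel₀ hN'.ne', one_smul, hg0] at this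
  simpa using this.symm

lemma nsqV_nonneg (v : V3) : 0 ≤ nsqV v := Finset.sum_nonneg fun _ _ => sq_nonneg _

lemma gradSq_nonneg (ψ : V3 → ℂ) (x : V3) : 0 ≤ gradSq ψ x :=
  Finset.sum_nonneg fun _ _ => Complex.normSq_nonneg _

lemma dualSum_nonneg (N : ℕ) (f : V3 → ℝ) : 0 ≤ dualSum N f := by
  refine tsum_nonneg fun k => ?_
  split_ifs
  · exact le_rfl
  · exact div_nonneg (Complex.normSq_nonneg _) (nsqV_nonneg _)

lemma const_of_grad (N : ℕ) (hN : 0 < N) (ψ : V3 → ℂ) (hp : IsPerN N ψ) (hr : ContDiff ℝ 1 ψ)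
    (hi : ∫ x in cubeN N, gradSq ψ x = 0) : ∀ x, ψ x = ψ 0 := by
  have hcont : Continuous (gradSq ψ) := by
    unfold gradSq
    have h1 : Continuous (fderiv ℝ ψ) := hr.continuous_fderiv one_ne_zero
    refine continuous_finset_sum _ fun i _ => Complex.continuous_normSq.comp ?_
    exact h1.clm_apply continuous_const
  have hper : IsPerN N (gradSq ψ) := by
    intro x k
    unfold gradSq
    have : fderiv ℝ ψ (x + fun i => (N : ℝ) * (k i : ℝ)) = fderiv ℝ ψ x := by
      rw [← fderiv_comp_add_right]
      congr 1
      ext y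
      exact hp y k
    rw [this]
  have h0 := nonneg_int_zero N hN _ hcont hper (gradSq_nonneg ψ) hi
  intro x
  refine is_const_of_fderiv_eq_zero (𝕜 := ℝ) (hr.differentiable one_ne_zero) (fun y => ?_) x 0
  have h1 := h0 y
  unfold gradSq at h1
  rw [Finset.sum_eq_zero_iff_of_nonneg (fun _ _ => Complex.normSq_nonneg _)] at h1
  ext v
  rw [← Finset.univ_sum_single v, map_sum]
  simp only [ContinuousLinearMap.zero_apply]
  refine Finset.sum_eq_zero fun i hi => ?_
  have h2 := Complex.normSq_eq_zero.1 (h1 i hi)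
  have h3 : (Pi.single i (v i) : V3) = v i • Pi.single i (1 : ℝ) := by
    rw [← Pi.single_smul]; simp
  rw [h3, map_smul, h2, smul_zero]

lemma int_const (N : ℕ) (hN : 0 < N) (c : ℝ) : ∫ _ in cubeN N, c = (N : ℝ) ^ 3 * c := by
  rw [torus_int N hN (fun _ => c) (fun _ => c) (fun _ => rfl)]
  simp

/-- description of all ground states under the Jellium condition. -/
theorem stmt4 (N : ℕ) (hN : 0 < N) (σ : V3 → ℝ) (e Z M : ℝ)
    (he : 0 < e) (hZ : 0 < Z) (hM : 0 < M)
    (hper : IsPerN N σ) (hreg : ContDiff ℝ 2 σ)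
    (hint : (∫ x in cubeN N, σ x) = e * Z)
    (hJ : JelliumCond N σ) :
    (∀ (ψ : V3 → ℂ) (q p : GammaIdx N → V3), IsPerN N ψ → ContDiff ℝ 1 ψ →
        0 ≤ energyE N σ e M ψ q p) ∧
      (∀ (ψ : V3 → ℂ) (q p : GammaIdx N → V3), IsPerN N ψ → ContDiff ℝ 1 ψ →
        (∫ x in cubeN N, Complex.normSq (ψ x)) = Z * (N : ℝ) ^ 3 →
        (energyE N σ e M ψ q p = 0 ↔
          ∃ α : ℝ,
            (∀ x : V3, ψ x = Complex.exp (Complex.I * (α : ℂ)) * ((Real.sqrt Z : ℝ) : ℂ)) ∧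
            (∀ n : GammaIdx N, p n = 0) ∧
            (∀ x : V3, (∑ n : GammaIdx N, σ (x - embG n - q n)) = e * Z))) := by
  have e3 : ∀ (ψ : V3 → ℂ) (q p : GammaIdx N → V3), 0 ≤ (1 / 2) * (∫ x in cubeN N, gradSq ψ x) ∧
      0 ≤ (2 * (N : ℝ) ^ 3)⁻¹ * dualSum N (rhoT N σ e ψ q) ∧
      0 ≤ (2 * M)⁻¹ * ∑ n : GammaIdx N, nsqV (p n) := by
    intro ψ q p
    refine ⟨mul_nonneg (by norm_num) (integral_nonneg (gradSq_nonneg ψ)),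
      mul_nonneg (by positivity) (dualSum_nonneg _ _),
      mul_nonneg (by positivity) (Finset.sum_nonneg fun n _ => nsqV_nonneg _)⟩
  have hN' : (0 : ℝ) < N := by exact_mod_cast hN
  have hσc : Continuous σ := hreg.continuous
  refine ⟨fun ψ q p _ _ => ?_, fun ψ q p hψ hψr hnorm => ⟨fun hE => ?_, ?_⟩⟩
  · obtain ⟨h1, h2, h3⟩ := e3 ψ q p
    unfold energyE
    linarith
  · obtain ⟨h1, h2, h3⟩ := e3 ψ q p
    unfold energyE at hE
    have k1 : (1 / 2) * (∫ x in cubeN N, gradSq ψ x) = 0 := by linarith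
    have k2 : (2 * (N : ℝ) ^ 3)⁻¹ * dualSum N (rhoT N σ e ψ q) = 0 := by linarith
    have k3 : (2 * M)⁻¹ * ∑ n : GammaIdx N, nsqV (p n) = 0 := by linarith
    have l1 := (mul_eq_zero.1 k1).resolve_left (by norm_num)
    have l2 := (mul_eq_zero.1 k2).resolve_left (by positivity)
    have l3 := (mul_eq_zero.1 k3).resolve_left (by positivity)
    have hc := const_of_grad N hN ψ hψ hψr l1
    have hn0 : Complex.normSq (ψ 0) = Z := by
      simp_rw [fun x => hc x] at hnorm
      rw [int_const N hN] at hnorm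
      have : (N : ℝ) ^ 3 ≠ 0 := by positivity
      apply mul_left_cancel₀ this
      linarith
    have hρ0 := summ_zero N hN (rhoT N σ e ψ q) (by
        unfold rhoT
        have := hψr.continuous
        have h4 := Complex.continuous_normSq.comp this
        refine Continuous.sub (continuous_finset_sum _ fun n _ => ?_) (continuous_const.mul h4)
        fun_prop) (by
        intro x k
        unfold rhoT
        rw [hψ]
        congr 1
        refine Finset.sum_congr rfl fun n _ => ?_
        rw [← hper (x - embG n - q n) k]
        congr 1
        abel) (by
        unfold rhoT
        simp_rw [fun x => hc x, hn0]
        have hfin : volume (cubeN N) < ⊤ := by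
          have : cubeN N ⊆ Set.Icc 0 (fun _ => (N : ℝ)) := fun x hx =>
            ⟨fun i => (hx i).1, fun i => (hx i).2.le⟩
          exact lt_of_le_of_lt (measure_mono this) isCompact_Icc.measure_lt_top
        have hI : ∀ f : V3 → ℝ, Continuous f → IntegrableOn f (cubeN N) := by
          intro f hf
          have : cubeN N ⊆ Set.Icc 0 (fun _ => (N : ℝ)) := fun x hx =>
            ⟨fun i => (hx i).1, fun i => (hx i).2.le⟩
          exact (hf.continuousOn.integrableOn_compact isCompact_Icc).mono_set this
        have hI2 : ∀ n : GammaIdx N, IntegrableOn (fun x => σ (x - embG n - q n)) (cubeN N) :=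
          fun n => hI _ (by fun_prop)
        rw [integral_sub (integrable_finset_sum _ fun n _ => hI2 n) (hI _ continuous_const),
          integral_finset_sum _ fun n _ => hI2 n, int_const N hN]
        have : ∀ n : GammaIdx N, ∫ x in cubeN N, σ (x - embG n - q n) = e * Z := by
          intro n
          simp_rw [sub_sub]
          rw [int_translate N hN σ hσc hper, hint]
        simp_rw [this]
        simp) l2
    refine ⟨(ψ 0).arg, fun x => ?_, fun n => ?_, fun x => ?_⟩
    · rw [hc x, ← hn0, ← Complex.norm_def]
      rw [mul_comm, mul_comm Complex.I]
      exact (Complex.norm_mul_exp_arg_mul_I _).symm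
    · have h5 := (Finset.sum_eq_zero_iff_of_nonneg (fun n _ => nsqV_nonneg (p n))).1 l3 n
        (Finset.mem_univ n)
      unfold nsqV at h5
      rw [Finset.sum_eq_zero_iff_of_nonneg (fun _ _ => sq_nonneg _)] at h5
      ext i
      simpa using h5 i (Finset.mem_univ i)
    · have := hρ0 x
      unfold rhoT at this
      rw [hc x, hn0] at this
      linarith
  · rintro ⟨α, hα, hp0, hσ⟩
    have hn : ∀ x, Complex.normSq (ψ x) = Z := by
      intro x
      rw [hα x, Complex.normSq_mul, Complex.normSq_ofReal, Real.mul_self_sqrt hZ.le,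
        Complex.normSq_eq_norm_sq, mul_comm Complex.I, Complex.norm_exp_ofReal_mul_I]
      simp
    have hψc : ψ = fun _ => Complex.exp (Complex.I * (α : ℂ)) * ((Real.sqrt Z : ℝ) : ℂ) :=
      funext hα
    have hr : rhoT N σ e ψ q = fun _ => 0 := by
      funext x
      unfold rhoT
      rw [hσ, hn]; ring
    have hg : ∀ x, gradSq ψ x = 0 := by
      intro x
      unfold gradSq
      rw [hψc]
      simp
    unfold energyE
    rw [hr]
    simp [hg, hp0, nsqV, dualSum, fCoeffR, fCoeff]

end SPN
end
end

section
/- Assume the Jellium condition. Set Π*_N := Γ*_N ∩ [0,2π)³ and, for θ ∈ Γ*_N and κ : Γ_N → ℝ³, let κ̂(θ) := ∑_{n∈Γ_N} e^{iθ·n} κ(n) ∈ ℂ³. Then for every r ∈ ℝ³, N^{−3} ∑_{ξ∈Γ*_N\{0}} |σ̂^{(1)}(ξ)|²/|ξ|² = N^{−3} ∑_{θ∈Π*_N\{0}} ⟨κ̂(θ), Σ(θ) κ̂(θ)⟩, where σ^{(1)}(x) := −∑_{n∈Γ_N} κ(n)·∇σ(x−n−r) and ⟨·,·⟩ is the Hermitian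 inner product on ℂ³. -/
noncomputable section

namespace SPN

open MeasureTheory Finset
open scoped Real

/-- The plane wave. -/
def EE (ξ x : V3) : ℂ := Complex.exp (Complex.I * ((dotP ξ x : ℝ) : ℂ))

lemma dotP_add (ξ x y : V3) : dotP ξ (x + y) = dotP ξ x + dotP ξ y := by
  simp [dotP, mul_add, Finset.sum_add_distrib]

lemma EE_add (ξ x y : V3) : EE ξ (x + y) = EE ξ x * EE ξ y := by
  simp only [EE, dotP_add, ← Complex.exp_add]
  congr 1; push_cast; ring

lemma EE_norm (ξ x : V3) : ‖EE ξ x‖ = 1 := by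
  rw [EE, mul_comm]; exact Complex.norm_exp_ofReal_mul_I _

lemma EE_cont (ξ : V3) : Continuous (EE ξ) := by
  unfold EE dotP; fun_prop

lemma EE_per (N : ℕ) (hN : 0 < N) (k : Fin 3 → ℤ) : IsPerN N (EE (xiN N k)) := by
  intro x j
  rw [EE_add]
  have : EE (xiN N k) (fun i => (N : ℝ) * (j i : ℝ)) = 1 := by
    rw [EE, Complex.exp_eq_one_iff]
    refine ⟨∑ i, k i * j i, ?_⟩
    have hN' : (N : ℂ) ≠ 0 := by exact_mod_cast hN.ne'
    simp only [dotP, xiN]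
    push_cast
    rw [Finset.mul_sum, Finset.sum_mul]
    refine Finset.sum_congr rfl fun i _ => ?_
    field_simp
  rw [this, mul_one]

lemma cube_eq (N : ℕ) : cubeN N = Set.pi Set.univ fun _ : Fin 3 => Set.Ico (0 : ℝ) N := by
  ext x; simp [cubeN]

lemma cube_ae (N : ℕ) : cubeN N =ᵐ[volume] Set.Icc (fun _ : Fin 3 => (0 : ℝ)) (fun _ => (N : ℝ)) := by
  rw [cube_eq]; exact Measure.univ_pi_Ico_ae_eq_Icc

lemma cube_int (N : ℕ) (f : V3 → ℂ) (hf : Continuous f) : IntegrableOn f (cubeN N) :=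
  (hf.continuousOn.integrableOn_compact (isCompact_Icc (a := fun _ : Fin 3 => (0 : ℝ))
    (b := fun _ => (N : ℝ)))).congr_set_ae (cube_ae N)

open scoped Pointwise in
lemma trans_inv (N : ℕ) (hN : 0 < N) (f : V3 → ℂ) (hf : IsPerN N f) (t : V3) :
    ∫ x in cubeN N, f (x - t) = ∫ x in cubeN N, f x := by
  have hN' : (N : ℝ) ≠ 0 := by exact_mod_cast hN.ne'
  have hNp : (0 : ℝ) < N := by exact_mod_cast hN
  let b : Module.Basis (Fin 3) ℝ V3 := (Pi.basisFun ℝ (Fin 3)).unitsSMul (fun _ => Units.mk0 (N : ℝ) hN')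
  have hb : ∀ i, b i = (N : ℝ) • Pi.single i 1 := by
    intro i; simp [b, Module.Basis.unitsSMul_apply, Units.smul_def]
  have hrepr : ∀ x i, b.repr x i = (N : ℝ)⁻¹ * x i := by
    intro x i
    simp [b, Module.Basis.repr_unitsSMul, Units.smul_def]
  have hfd : ZSpan.fundamentalDomain b = cubeN N := by
    ext x
    simp only [ZSpan.mem_fundamentalDomain, hrepr, cubeN, Set.mem_ofPred_eq, Set.mem_Ico]
    refine forall_congr' fun i => ?_
    rw [inv_mul_lt_iff₀ hNp, mul_one]
    refine and_congr ?_ Iff.rfl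
    constructor
    · intro h; have := mul_nonneg hNp.le h; rwa [mul_inv_cancel_left₀ hN'] at this
    · intro h; positivity
  have h1 := ZSpan.isAddFundamentalDomain b (volume : Measure V3)
  have hcount : Countable (Submodule.span ℤ (Set.range b)) := inferInstance
  have h2 : IsAddFundamentalDomain (Submodule.span ℤ (Set.range b)) ((-t) +ᵥ ZSpan.fundamentalDomain b) (volume : Measure V3) :=
    h1.vadd_of_comm (-t)
  have hinv : ∀ (g : Submodule.span ℤ (Set.range b)) (x : V3), f (g +ᵥ x) = f x := by
    intro g x
    have hg := (Module.Basis.mem_span_iff_repr_mem ℤ b g.1).1 g.2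
    choose k hk using hg
    have : (g +ᵥ x : V3) = x + fun i => (N : ℝ) * (k i : ℝ) := by
      funext i
      have := hk i
      rw [hrepr] at this
      simp only [Submodule.vadd_def, vadd_eq_add, Pi.add_apply]
      have h3 : (k i : ℝ) = (N : ℝ)⁻¹ * g.1 i := by simpa using this
      rw [h3, mul_inv_cancel_left₀ hN', add_comm]
    rw [this, hf]
  have hvi : VAddInvariantMeasure (Submodule.span ℤ (Set.range b)) V3 (volume : Measure V3) :=
    ⟨fun g s _ => measure_preimage_add (volume : Measure V3) g.1 s⟩
  have h3 := h2.setIntegral_eq h1 (f := f) hinv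
  rw [← hfd, ← h3]
  have := (measurePreserving_vadd (-t) (volume : Measure V3)).setIntegral_image_emb (measurableEmbedding_const_vadd (-t)) f (ZSpan.fundamentalDomain b)
  rw [← Set.image_vadd, this]
  refine integral_congr_ae (Filter.Eventually.of_forall fun x => ?_)
  simp [sub_eq_neg_add]

lemma byparts (N : ℕ) (g : V3 → ℂ) (hg : IsPerN N g) (hc : ContDiff ℝ 1 g) (a : Fin 3) :
    ∫ x in cubeN N, fderiv ℝ g x (Pi.single a 1) = 0 := by
  have hcf : Continuous (fun x => fderiv ℝ g x (Pi.single a 1)) :=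
    (hc.continuous_fderiv one_ne_zero).clm_apply continuous_const
  have hle : (fun _ : Fin 3 => (0 : ℝ)) ≤ (fun _ => (N : ℝ)) := fun i => by positivity
  have hs : ∀ x, (∑ i, (if i = a then fderiv ℝ g x else 0) (Pi.single i 1)) = fderiv ℝ g x (Pi.single a 1) := by
    intro x
    rw [Finset.sum_eq_single a] <;> simp +contextual
  have := integral_divergence_of_hasFDerivAt_off_countable' (fun _ : Fin 3 => (0 : ℝ)) (fun _ => (N : ℝ))
    hle (fun i x => if i = a then g x else 0) (fun i x => if i = a then fderiv ℝ g x else 0) ∅ Set.countable_empty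
    (fun i => by
      by_cases h : i = a
      · simp only [h, if_true]; exact hc.continuous.continuousOn
      · simp only [h, if_false]; exact continuousOn_const)
    (fun x _ i => by
      by_cases h : i = a
      · simp only [h, if_true]; exact (hc.differentiable one_ne_zero x).hasFDerivAt
      · simp only [h, if_false]; exact hasFDerivAt_const _ _)
    (by
      simp only [hs]
      exact hcf.continuousOn.integrableOn_compact isCompact_Icc)
  simp only [hs] at this
  rw [setIntegral_congr_set (cube_ae N), this]
  refine Finset.sum_eq_zero fun i _ => ?_
  rw [sub_eq_zero]
  refine integral_congr_ae (Filter.Eventually.of_forall fun x => ?_)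
  by_cases h : i = a
  · simp only [h, if_true]
    rw [← hg (a.insertNth 0 x) (Pi.single a 1)]
    congr 1
    funext j
    refine Fin.succAboveCases a ?_ (fun j => ?_) j
    · simp
    · simp [Fin.succAbove_ne]
  · simp [h]

lemma EE_hasFDeriv (ξ x : V3) : HasFDerivAt (EE ξ)
    (EE ξ x • (Complex.I • Complex.ofRealCLM.comp (∑ i, ξ i • ContinuousLinearMap.proj (R := ℝ) (φ := fun _ : Fin 3 => ℝ) i))) x := by
  have h1 : HasFDerivAt (fun x : V3 => dotP ξ x) (∑ i, ξ i • ContinuousLinearMap.proj (R := ℝ) (φ := fun _ : Fin 3 => ℝ) i) x := by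
    have := (∑ i, ξ i • ContinuousLinearMap.proj (R := ℝ) (φ := fun _ : Fin 3 => ℝ) i).hasFDerivAt (x := x)
    refine this.congr_of_eventuallyEq (Filter.Eventually.of_forall fun y => ?_)
    simp [dotP]
  exact ((Complex.ofRealCLM.hasFDerivAt.comp x h1).const_mul Complex.I).cexp

lemma EE_contDiff (ξ : V3) : ContDiff ℝ 1 (EE ξ) := by
  have h1 : ∀ i : Fin 3, ContDiff ℝ 1 (fun x : V3 => ξ i * x i) := fun i =>
    contDiff_const.mul (contDiff_apply ℝ ℝ i)
  have h2 : ContDiff ℝ 1 (fun x : V3 => dotP ξ x) :=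
    ContDiff.sum (s := (Finset.univ : Finset (Fin 3))) fun i _ => h1 i
  have h3 : ContDiff ℝ 1 (fun x : V3 => ((dotP ξ x : ℝ) : ℂ)) := Complex.ofRealCLM.contDiff.comp h2
  exact (contDiff_const.mul h3).cexp

lemma gradV_per (N : ℕ) (σ : V3 → ℝ) (hper : IsPerN N σ) : IsPerN N (gradV σ) := by
  intro x k
  funext i
  simp only [gradV]
  rw [← fderiv_comp_add_right]
  have : (fun y => σ (y + fun i => (N : ℝ) * (k i : ℝ))) = σ := funext fun y => hper y k
  rw [this]

lemma grad_coeff (N : ℕ) (hN : 0 < N) (σ : V3 → ℝ) (hper : IsPerN N σ) (hreg : ContDiff ℝ 2 σ)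
    (k : Fin 3 → ℤ) (a : Fin 3) :
    ∫ x in cubeN N, EE (xiN N k) x * ((gradV σ x a : ℝ) : ℂ) =
      -(Complex.I * (xiN N k a : ℂ)) * fCoeffR N σ (xiN N k) := by
  set ξ := xiN N k with hξ
  have hσ1 : ContDiff ℝ 1 σ := hreg.of_le (by norm_num)
  have hσc : ContDiff ℝ 1 (fun x => ((σ x : ℝ) : ℂ)) := Complex.ofRealCLM.contDiff.comp hσ1
  have h := byparts N (fun x => EE ξ x * ((σ x : ℝ) : ℂ))
    (fun x j => by simp only [hξ, EE_per N hN k x j, hper x j])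
    ((EE_contDiff ξ).mul hσc) a
  have hd : ∀ x, fderiv ℝ (fun x => EE ξ x * ((σ x : ℝ) : ℂ)) x (Pi.single a 1) =
      EE ξ x * ((gradV σ x a : ℝ) : ℂ) + (Complex.I * (ξ a : ℂ)) * (EE ξ x * ((σ x : ℝ) : ℂ)) := by
    intro x
    have h2 : HasFDerivAt (fun x => ((σ x : ℝ) : ℂ)) (Complex.ofRealCLM.comp (fderiv ℝ σ x)) x :=
      Complex.ofRealCLM.hasFDerivAt.comp x ((hσ1.differentiable one_ne_zero) x).hasFDerivAt
    have h3 : HasFDerivAt (fun x => EE ξ x * ((σ x : ℝ) : ℂ)) _ x := (EE_hasFDeriv ξ x).mul h2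
    rw [h3.fderiv]
    simp [gradV, _root_.sum_apply, Pi.single_apply]
    ring
  simp only [hd] at h
  have hgc : Continuous fun x => gradV σ x a :=
    (hσ1.continuous_fderiv one_ne_zero).clm_apply continuous_const
  rw [integral_add, integral_const_mul] at h
  · rw [eq_neg_of_add_eq_zero_left h, neg_mul]; rfl
  · exact cube_int N _ ((EE_cont ξ).mul (Complex.continuous_ofReal.comp hgc))
  · exact cube_int N _ (continuous_const.mul ((EE_cont ξ).mul hσc.continuous))

lemma sigma1_coeff (N : ℕ) (hN : 0 < N) (σ : V3 → ℝ) (hper : IsPerN N σ) (hreg : ContDiff ℝ 2 σ)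
    (r : V3) (κ : GammaIdx N → V3) (k : Fin 3 → ℤ) :
    fCoeffR N (sigma1F N σ r κ) (xiN N k) =
      Complex.I * EE (xiN N k) r * fCoeffR N σ (xiN N k) *
        ∑ a, (xiN N k a : ℂ) * hatK N κ (xiN N k) a := by
  set ξ := xiN N k with hξ
  have hσ1 : ContDiff ℝ 1 σ := hreg.of_le (by norm_num)
  have hgc : ∀ a, Continuous fun x => gradV σ x a := fun a =>
    (hσ1.continuous_fderiv one_ne_zero).clm_apply continuous_const
  have hexp : ∀ x, EE ξ x * ((sigma1F N σ r κ x : ℝ) : ℂ) =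
      ∑ n : GammaIdx N, ∑ a, (-(κ n a : ℂ) * EE ξ (embG n + r)) *
        (EE ξ (x - (embG n + r)) * ((gradV σ (x - (embG n + r)) a : ℝ) : ℂ)) := by
    intro x
    simp only [sigma1F, dotP]
    push_cast
    rw [← Finset.sum_neg_distrib, Finset.mul_sum]
    refine Finset.sum_congr rfl fun n _ => ?_
    rw [← Finset.sum_neg_distrib, Finset.mul_sum]
    refine Finset.sum_congr rfl fun a _ => ?_
    have : EE ξ x = EE ξ (embG n + r) * EE ξ (x - (embG n + r)) := by
      rw [← EE_add]; congr 1; abel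
    rw [this, sub_sub]; ring
  have hstep : ∀ (n : GammaIdx N) (a : Fin 3),
      ∫ x in cubeN N, (-(κ n a : ℂ) * EE ξ (embG n + r)) *
        (EE ξ (x - (embG n + r)) * ((gradV σ (x - (embG n + r)) a : ℝ) : ℂ)) =
      (-(κ n a : ℂ) * EE ξ (embG n + r)) * (-(Complex.I * (ξ a : ℂ)) * fCoeffR N σ ξ) := by
    intro n a
    rw [integral_const_mul, ← grad_coeff N hN σ hper hreg k a]
    congr 1
    exact trans_inv N hN (fun x => EE ξ x * ((gradV σ x a : ℝ) : ℂ))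
      (fun x j => by simp only [hξ, EE_per N hN k x j, gradV_per N σ hper x j]) (embG n + r)
  have hi : ∀ (n : GammaIdx N) (a : Fin 3), IntegrableOn (fun x => (-(κ n a : ℂ) * EE ξ (embG n + r)) *
        (EE ξ (x - (embG n + r)) * ((gradV σ (x - (embG n + r)) a : ℝ) : ℂ))) (cubeN N) := by
    intro n a
    refine cube_int N _ (continuous_const.mul (Continuous.mul ?_ ?_))
    · exact (EE_cont ξ).comp (continuous_id.sub continuous_const)
    · exact Complex.continuous_ofReal.comp ((hgc a).comp (continuous_id.sub continuous_const))
  have h0 : fCoeffR N (sigma1F N σ r κ) ξ = ∫ x in cubeN N, EE ξ x * ((sigma1F N σ r κ x : ℝ) : ℂ) := rfl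
  rw [h0]
  simp only [hexp]
  rw [integral_finsetSum _ (fun n _ => integrable_finsetSum _ (fun a _ => hi n a))]
  simp only [hatK, Finset.mul_sum]
  rw [Finset.sum_comm (s := (Finset.univ : Finset (Fin 3)))]
  refine Finset.sum_congr rfl fun n _ => ?_
  rw [integral_finsetSum _ (fun a _ => hi n a)]
  refine Finset.sum_congr rfl fun a _ => ?_
  rw [hstep, EE_add]
  simp only [EE]
  ring

lemma EE_orth (N : ℕ) (hN : 0 < N) (k : Fin 3 → ℤ) (hk : k ≠ 0) :
    ∫ x in cubeN N, EE (xiN N k) x = 0 := by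
  set ξ := xiN N k with hξ
  obtain ⟨i, hi⟩ : ∃ i, k i ≠ 0 := by
    by_contra h; push Not at h; exact hk (funext h)
  have hN' : (N : ℝ) ≠ 0 := by exact_mod_cast hN.ne'
  have hξi : ξ i ≠ 0 := by
    simp only [hξ, xiN]
    have : (k i : ℝ) ≠ 0 := by exact_mod_cast hi
    have := Real.pi_ne_zero
    positivity
  let t : V3 := Pi.single i (-(π / ξ i))
  have h := trans_inv N hN (EE ξ) (EE_per N hN k) t
  have ht : ∀ x, EE ξ (x - t) = EE ξ x * (-1) := by
    intro x
    rw [sub_eq_add_neg, EE_add]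
    congr 1
    have : dotP ξ (-t) = π := by
      simp [dotP, t, Pi.single_apply]
      field_simp
    rw [EE, this, mul_comm, Complex.exp_pi_mul_I]
  simp only [ht] at h
  rw [integral_mul_const] at h
  linear_combination (-1/2 : ℂ) * h

lemma vol_cube (N : ℕ) : volume.real (cubeN N) = (N : ℝ) ^ 3 := by
  rw [cube_eq, Measure.real, volume_pi, Measure.pi_pi]
  simp

lemma bessel (N : ℕ) (hN : 0 < N) (σ : V3 → ℝ) (hc : Continuous σ) :
    Summable fun k : Fin 3 → ℤ => Complex.normSq (fCoeffR N σ (xiN N k)) := by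
  classical
  let μ : Measure V3 := volume.restrict (cubeN N)
  have hbd : ∀ f : V3 → ℂ, Continuous f → MemLp f 2 μ := by
    intro f hf
    refine (memLp_two_iff_integrable_sq_norm hf.aestronglyMeasurable).2 ?_
    have := (cube_int N (fun x => ((‖f x‖ ^ 2 : ℝ) : ℂ)) (by fun_prop)).re
    refine this.congr (Filter.Eventually.of_forall fun x => ?_)
    exact Complex.ofReal_re _
  have hE : ∀ k, MemLp (fun x => (starRingEnd ℂ) (EE (xiN N k) x)) 2 μ := fun k =>
    hbd _ (Complex.continuous_conj.comp (EE_cont _))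
  have hS : MemLp (fun x => ((σ x : ℝ) : ℂ)) 2 μ := hbd _ (by fun_prop)
  have hNp : (0 : ℝ) < (N : ℝ) ^ 3 := by positivity
  let c : ℂ := ((Real.sqrt ((N : ℝ) ^ 3))⁻¹ : ℝ)
  have hc2 : c * (starRingEnd ℂ) c = (((N : ℝ) ^ 3)⁻¹ : ℝ) := by
    simp only [c, Complex.conj_ofReal]
    rw [← Complex.ofReal_mul, ← mul_inv, Real.mul_self_sqrt hNp.le]
  let v : (Fin 3 → ℤ) → Lp ℂ 2 μ := fun k => c • (hE k).toLp
  have hsub : ∀ k l x, EE (xiN N k) x * (starRingEnd ℂ) (EE (xiN N l) x) = EE (xiN N (k - l)) x := by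
    intro k l x
    simp only [EE, ← Complex.exp_conj, ← Complex.exp_add]
    congr 1
    simp only [map_mul, Complex.conj_I, Complex.conj_ofReal]
    have : dotP (xiN N (k - l)) x = dotP (xiN N k) x - dotP (xiN N l) x := by
      simp only [dotP, xiN, ← Finset.sum_sub_distrib, Pi.sub_apply]
      refine Finset.sum_congr rfl fun i _ => ?_
      push_cast; ring
    rw [this]; push_cast; ring
  have hv : Orthonormal ℂ v := by
    rw [orthonormal_iff_ite]
    intro k l
    have h1 : inner ℂ ((hE k).toLp) ((hE l).toLp) = ∫ x, EE (xiN N (k - l)) x ∂μ := by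
      rw [L2.inner_def]
      refine integral_congr_ae ?_
      filter_upwards [(hE k).coeFn_toLp, (hE l).coeFn_toLp] with x h1 h2
      rw [h1, h2, ← hsub]
      simp [RCLike.inner_apply, mul_comm]
    simp only [v, inner_smul_left, inner_smul_right]
    rw [h1, ← mul_assoc, hc2]
    split_ifs with h
    · subst h
      have : ∀ x, EE (xiN N (k - k)) x = 1 := by
        intro x; simp [EE, xiN, dotP]
      simp only [this]
      rw [integral_const]
      simp only [μ, measureReal_restrict_apply_univ, vol_cube]
      rw [Complex.real_smul, mul_one, ← Complex.ofReal_mul, inv_mul_cancel₀ hNp.ne', Complex.ofReal_one]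
    · rw [EE_orth N hN _ (sub_ne_zero.2 h), mul_zero]
  have hsum := hv.inner_products_summable (x := hS.toLp)
  have hval : ∀ k, ‖inner ℂ (v k) (hS.toLp)‖ ^ 2 = ((N : ℝ) ^ 3)⁻¹ * Complex.normSq (fCoeffR N σ (xiN N k)) := by
    intro k
    have h1 : inner ℂ ((hE k).toLp) (hS.toLp) = fCoeffR N σ (xiN N k) := by
      rw [L2.inner_def]
      refine integral_congr_ae ?_
      filter_upwards [(hE k).coeFn_toLp, hS.coeFn_toLp] with x h1 h2
      rw [h1, h2]
      simp [RCLike.inner_apply, mul_comm, EE]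
    simp only [v, inner_smul_left]
    rw [h1, norm_mul, mul_pow, Complex.normSq_eq_norm_sq, RCLike.norm_conj]
    congr 1
    simp only [c, Complex.norm_real]
    rw [norm_inv, inv_pow, Real.norm_eq_abs, sq_abs, Real.sq_sqrt hNp.le]
  simp only [hval] at hsum
  exact (summable_mul_left_iff (inv_ne_zero hNp.ne')).1 hsum

/-- Division with remainder in `ℤ³`. -/
def dmEquiv (N : ℕ) [NeZero N] : (Fin 3 → ℤ) ≃ (Fin 3 → Fin N) × (Fin 3 → ℤ) :=
  ((Equiv.arrowCongr (Equiv.refl (Fin 3)) (Int.divModEquiv N)).trans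
    (Equiv.arrowProdEquivProdArrow (Fin 3) (fun _ => ℤ) (fun _ => Fin N))).trans (Equiv.prodComm _ _)

lemma dmEquiv_symm (N : ℕ) [NeZero N] (m : Fin 3 → Fin N) (j : Fin 3 → ℤ) (i : Fin 3) :
    (dmEquiv N).symm (m, j) i = j i * N + ((m i : ℕ) : ℤ) := rfl

lemma xiN_dm (N : ℕ) [NeZero N] (m : Fin 3 → Fin N) (j : Fin 3 → ℤ) :
    xiN N ((dmEquiv N).symm (m, j)) =
      fun i => xiN N (fun i => ((m i : ℕ) : ℤ)) i + 2 * π * (j i : ℝ) := by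
  funext i
  have hN' : (N : ℝ) ≠ 0 := by exact_mod_cast NeZero.ne N
  simp only [xiN, dmEquiv_symm]
  push_cast
  field_simp
  ring

lemma hatK_per (N : ℕ) (κ : GammaIdx N → V3) (θ : V3) (j : Fin 3 → ℤ) (a : Fin 3) :
    hatK N κ (fun i => θ i + 2 * π * (j i : ℝ)) a = hatK N κ θ a := by
  refine Finset.sum_congr rfl fun n _ => ?_
  congr 1
  rw [Complex.exp_eq_exp_iff_exists_int]
  refine ⟨∑ i, j i * ((n i : ℕ) : ℤ), ?_⟩
  simp only [dotP, embG]
  push_cast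
  rw [Finset.mul_sum, Finset.mul_sum, Finset.sum_mul, ← Finset.sum_add_distrib]
  refine Finset.sum_congr rfl fun i _ => ?_
  ring

lemma coef_le_one (v : V3) (a b : Fin 3) : |v a * v b / nsqV v| ≤ 1 := by
  have h0 : 0 ≤ nsqV v := Finset.sum_nonneg fun i _ => sq_nonneg _
  have hi : ∀ i, v i ^ 2 ≤ nsqV v := fun i =>
    Finset.single_le_sum (f := fun i => v i ^ 2) (fun i _ => sq_nonneg _) (Finset.mem_univ i)
  rw [abs_div, abs_of_nonneg h0]
  refine div_le_one_of_le₀ ?_ h0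
  have ha := hi a
  have hb := hi b
  rw [abs_le]
  constructor <;> nlinarith [sq_nonneg (v a - v b), sq_nonneg (v a + v b)]

/-- the Fourier identity expressing `(σ⁽¹⁾, Gσ⁽¹⁾)` through `Σ(θ)`. -/
theorem stmt6 (N : ℕ) (hN : 0 < N) (σ : V3 → ℝ) (e Z : ℝ) (he : 0 < e) (hZ : 0 < Z)
    (hper : IsPerN N σ) (hreg : ContDiff ℝ 2 σ)
    (hint : (∫ x in cubeN N, σ x) = e * Z)
    (hJ : JelliumCond N σ) :
    ∀ (r : V3) (κ : GammaIdx N → V3),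
      (((((N : ℝ) ^ 3)⁻¹ * dualSum N (sigma1F N σ r κ) : ℝ)) : ℂ) =
        (((((N : ℝ) ^ 3)⁻¹ : ℝ)) : ℂ) *
          ∑ m : GammaIdx N,
            if (∀ i, (m i : ℕ) = 0) then 0 else
              ∑ a : Fin 3, ∑ b : Fin 3,
                (starRingEnd ℂ) (hatK N κ (xiN N (fun i => ((m i : ℕ) : ℤ))) a)
                  * (((SigMat N σ (xiN N (fun i => ((m i : ℕ) : ℤ))) a b : ℝ)) : ℂ)
                  * hatK N κ (xiN N (fun i => ((m i : ℕ) : ℤ))) b := by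
  intro r κ
  have : NeZero N := ⟨hN.ne'⟩
  have hbes := bessel N hN σ hreg.continuous
  have hbes2 : ∀ m : GammaIdx N, Summable fun j : Fin 3 → ℤ =>
      Complex.normSq (fCoeffR N σ (xiN N ((dmEquiv N).symm (m, j)))) := fun m =>
    hbes.comp_injective ((dmEquiv N).symm.injective.comp (Prod.mk_right_injective m))
  rw [Complex.ofReal_mul]
  congr 1
  let F : (Fin 3 → ℤ) → ℝ := fun k => if k = 0 then 0 else
    Complex.normSq (fCoeffR N (sigma1F N σ r κ) (xiN N k)) / nsqV (xiN N k)
  have hF0 : ∀ k, 0 ≤ F k := by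
    intro k
    simp only [F]
    split_ifs
    · exact le_rfl
    · exact div_nonneg (Complex.normSq_nonneg _) (Finset.sum_nonneg fun i _ => sq_nonneg _)
  have hFv : ∀ k, Complex.normSq (fCoeffR N (sigma1F N σ r κ) (xiN N k)) =
      Complex.normSq (fCoeffR N σ (xiN N k)) *
        Complex.normSq (∑ a, (xiN N k a : ℂ) * hatK N κ (xiN N k) a) := by
    intro k
    rw [sigma1_coeff N hN σ hper hreg]
    have : Complex.normSq (EE (xiN N k) r) = 1 := by
      rw [Complex.normSq_eq_norm_sq, EE_norm, one_pow]
    simp only [map_mul, this, Complex.normSq_I, one_mul]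
  have hG : ∀ m : GammaIdx N, HasSum (fun j => ((F ((dmEquiv N).symm (m, j)) : ℝ) : ℂ))
      (if (∀ i, (m i : ℕ) = 0) then 0 else
              ∑ a : Fin 3, ∑ b : Fin 3,
                (starRingEnd ℂ) (hatK N κ (xiN N (fun i => ((m i : ℕ) : ℤ))) a)
                  * (((SigMat N σ (xiN N (fun i => ((m i : ℕ) : ℤ))) a b : ℝ)) : ℂ)
                  * hatK N κ (xiN N (fun i => ((m i : ℕ) : ℤ))) b) := by
    intro m
    split_ifs with hm
    · have : (fun j => ((F ((dmEquiv N).symm (m, j)) : ℝ) : ℂ)) = fun _ => 0 := by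
        funext j
        simp only [F]
        split_ifs with hk
        · simp
        · have hj : j ≠ 0 := by
            rintro rfl
            exact hk (funext fun i => by simp [dmEquiv_symm, hm])
          have hz : fCoeffR N σ (xiN N ((dmEquiv N).symm (m, j))) = 0 := by
            rw [xiN_dm]
            have := hJ j hj
            simpa [xiN, hm] using this
          rw [hFv, hz]; simp
      rw [this]; exact hasSum_zero
    · set θ := xiN N (fun i => ((m i : ℕ) : ℤ)) with hθ
      have hterm : ∀ a b, HasSum (fun j : Fin 3 → ℤ =>
          ((θ a + 2 * π * (j a : ℝ)) * (θ b + 2 * π * (j b : ℝ))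
        / nsqV (fun i => θ i + 2 * π * (j i : ℝ)))
      * Complex.normSq (fCoeffR N σ (fun i => θ i + 2 * π * (j i : ℝ)))) (SigMat N σ θ a b) := by
        intro a b
        refine Summable.hasSum (Summable.of_norm_bounded (hbes2 m) fun j => ?_)
        rw [xiN_dm, norm_mul, Real.norm_eq_abs, Real.norm_eq_abs,
          abs_of_nonneg (Complex.normSq_nonneg _)]
        exact mul_le_of_le_one_left (Complex.normSq_nonneg _)
          (coef_le_one (fun i => θ i + 2 * π * (j i : ℝ)) a b)
      have hs := hasSum_sum (s := (Finset.univ : Finset (Fin 3))) fun a _ =>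
        hasSum_sum (s := (Finset.univ : Finset (Fin 3))) fun b _ =>
        (((Complex.hasSum_ofReal.2 (hterm a b)).mul_left
          ((starRingEnd ℂ) (hatK N κ θ a))).mul_right (hatK N κ θ b))
      refine hs.congr_fun fun j => ?_
      have hk : (dmEquiv N).symm (m, j) ≠ 0 := by
        intro h
        apply hm
        intro i
        have hi := congrFun h i
        rw [dmEquiv_symm, Pi.zero_apply] at hi
        have hlt := (m i).isLt
        have hdvd : (N : ℤ) ∣ ((m i : ℕ) : ℤ) := ⟨-j i, by linarith⟩
        exact Nat.eq_zero_of_dvd_of_lt (Int.natCast_dvd_natCast.1 hdvd) hlt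
      simp only [F, if_neg hk]
      rw [hFv, xiN_dm, ← hθ]
      simp only [hatK_per]
      generalize Complex.normSq (fCoeffR N σ fun i => θ i + 2 * π * (j i : ℝ)) = S
      generalize nsqV (fun i => θ i + 2 * π * (j i : ℝ)) = D
      generalize hatK N κ θ = K
      rw [Complex.ofReal_div, Complex.ofReal_mul, Complex.normSq_eq_conj_mul_self, map_sum,
        Finset.sum_mul_sum, Finset.mul_sum, Finset.sum_div]
      refine Finset.sum_congr rfl fun a _ => ?_
      rw [Finset.mul_sum, Finset.sum_div]
      refine Finset.sum_congr rfl fun b _ => ?_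
      rw [map_mul, Complex.conj_ofReal]
      rw [Complex.ofReal_mul, Complex.ofReal_div, Complex.ofReal_mul]
      ring
  have hGr : ∀ m : GammaIdx N, Summable fun j => F ((dmEquiv N).symm (m, j)) := fun m =>
    Complex.summable_ofReal.1 (hG m).summable
  have hsumm : Summable fun p : (Fin 3 → Fin N) × (Fin 3 → ℤ) => F ((dmEquiv N).symm p) :=
    (summable_prod_of_nonneg (fun p => hF0 _)).2 ⟨hGr, Summable.of_finite⟩
  have hd : dualSum N (sigma1F N σ r κ) = ∑' k, F k := rfl
  rw [hd, ← (dmEquiv N).symm.tsum_eq F, hsumm.tsum_prod' hGr, tsum_fintype, Complex.ofReal_sum]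
  refine Finset.sum_congr rfl fun m _ => ?_
  rw [Complex.ofReal_tsum, (hG m).tsum_eq]

end SPN
end
end
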